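/- (Crank–Nicolson scheme for the 1-D heat equation.) Let N_x ≥ 2, N_t ≥ 2, h = 1/N_x, τ > 0 and β = τ/h², and assume τ ≤ 1/8. Let n = N_x − 1, set A = I_n − (β/2)·L_h and B = I_n + (β/2)·L_h, and let L be the square matrix of size N_t·n, organized as an N_t×N_t array of n×n blocks, with A on the block diagonal, −B on the first block subdiagonal, and 0 elsewhere. Then every singular value σ of L satisfies 8τ ≤ σ ≤ max{2, 4β}. -/

import Mathlib

open Matrix

def IsSingularValue {𝕜 : Type*} [RCLike 𝕜] {n : Type*} [Fintype n] [DecidableEq n]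
    (M : Matrix n n 𝕜) (σ : ℝ) : Prop :=
  0 ≤ σ ∧ algebraMap ℝ 𝕜 (σ ^ 2) ∈ spectrum 𝕜 (M * Mᴴ)

/-- The `(Nx-1) × (Nx-1)` central-difference matrix `L_h`: symmetric tridiagonal with
`-2` on the main diagonal and `1` on the first sub- and super-diagonals. -/
def Lh (n : ℕ) : Matrix (Fin n) (Fin n) ℝ :=
  fun i j => if i = j then -2 else if (i : ℕ) = (j : ℕ) + 1 ∨ (j : ℕ) = (i : ℕ) + 1 then 1 else 0

/-- The `N·n × N·n` block matrix, organized as an `N × N` array of `n × n` blocks, with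
`D` on the block diagonal, `S` on the first block subdiagonal, and `0` elsewhere. -/
def blockBidiag {N n : ℕ} (D S : Matrix (Fin n) (Fin n) ℝ) :
    Matrix (Fin N × Fin n) (Fin N × Fin n) ℝ :=
  fun p q =>
    if p.1 = q.1 then D p.2 q.2
    else if (p.1 : ℕ) = (q.1 : ℕ) + 1 then S p.2 q.2 else 0

/-- A sum supported on at most one index is bounded by any nonnegative bound of its term. -/
lemma sum_ite_le_of_subsingleton {ι : Type*} [Fintype ι] (P : ι → Prop) [DecidablePred P]
    (hP : ∀ j k, P j → P k → j = k) (f : ι → ℝ) {c : ℝ} (hc : 0 ≤ c)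
    (hf : ∀ j, P j → f j ≤ c) : ∑ j, (if P j then f j else 0) ≤ c := by
  by_cases h : ∃ j, P j
  · obtain ⟨j, hj⟩ := h
    rw [Finset.sum_eq_single j (fun k _ hk => if_neg fun hPk => hk (hP k j hPk hj)) (by simp),
      if_pos hj]
    exact hf j hj
  · push Not at h
    simpa [h] using hc

lemma Lh_isHermitian (n : ℕ) : (Lh n).IsHermitian := by
  ext i j
  simp only [conjTranspose_apply, Lh, star_trivial, eq_comm (a := j) (b := i),
    or_comm (a := (j : ℕ) = (i : ℕ) + 1)]

/-- Comparison with the supersolution `i ↦ (i + 1) (n - i)` of the discrete Laplacian. -/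
lemma abs_two_add_le_of_Lh_mulVec_eq {n : ℕ} {l : ℝ} {e : Fin n → ℝ} (he : e ≠ 0)
    (hl : Lh n *ᵥ e = l • e) : |2 + l| ≤ 2 - 8 / ((n : ℝ) + 1) ^ 2 := by
  let s : ℕ → ℝ := fun i => ((i : ℝ) + 1) * (n - i)
  have hs : ∀ i : Fin n, 0 < s i := fun i => by
    have : (i : ℝ) < n := by exact_mod_cast i.2
    have : (0 : ℝ) < n - i := by linarith
    positivity
  obtain ⟨k, hk⟩ : ∃ k, e k ≠ 0 := Function.ne_iff.mp he
  obtain ⟨i, -, hi⟩ := Finset.exists_max_image Finset.univ (fun i : Fin n => |e i| / s i)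
    ⟨k, Finset.mem_univ k⟩
  set r := |e i| / s i with hr
  have hle : ∀ j, |e j| ≤ r * s j := fun j =>
    (div_le_iff₀ (hs j)).mp (hi j (Finset.mem_univ j))
  have hr0 : 0 < r := (div_pos (abs_pos.mpr hk) (hs k)).trans_le (hi k (Finset.mem_univ k))
  have hei : |e i| = r * s i := by rw [hr, div_mul_cancel₀ _ (hs i).ne']
  have hrow : (2 + l) * e i = ∑ j : Fin n, (if (i : ℕ) = j + 1 then e j else 0)
      + ∑ j : Fin n, (if (j : ℕ) = i + 1 then e j else 0) := by
    have h1 : ∑ j, Lh n i j * e j = l * e i := congrFun hl i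
    have h2 : ∑ j, Lh n i j * e j = ∑ j : Fin n, ((if i = j then -2 * e j else 0)
        + ((if (i : ℕ) = j + 1 then e j else 0) + (if (j : ℕ) = i + 1 then e j else 0))) := by
      refine Finset.sum_congr rfl fun j _ => ?_
      simp only [Lh, Fin.ext_iff]
      split_ifs <;> first | omega | simp
    rw [h2, Finset.sum_add_distrib, Finset.sum_add_distrib, Finset.sum_ite_eq,
      if_pos (Finset.mem_univ i)] at h1
    linarith
  have hin : (i : ℝ) + 1 ≤ n := by exact_mod_cast i.2
  have hi0 : (0 : ℝ) ≤ i := by positivity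
  have hlow : ∑ j : Fin n, |if (i : ℕ) = j + 1 then e j else 0| ≤ r * (i * (n - i + 1)) := by
    simp only [apply_ite abs, abs_zero]
    refine sum_ite_le_of_subsingleton _ (fun j k hj hk => Fin.ext (by omega)) _
      (mul_nonneg hr0.le (mul_nonneg hi0 (by linarith))) fun j hj => (hle j).trans_eq ?_
    simp only [s]
    rw [hj]; push_cast; ring
  have hhigh : ∑ j : Fin n, |if (j : ℕ) = i + 1 then e j else 0|
      ≤ r * ((i + 2) * (n - i - 1)) := by
    simp only [apply_ite abs, abs_zero]
    refine sum_ite_le_of_subsingleton _ (fun j k hj hk => Fin.ext (by omega)) _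
      (mul_nonneg hr0.le (mul_nonneg (by linarith) (by linarith)))
      fun j hj => (hle j).trans_eq ?_
    simp only [s]
    rw [hj]; push_cast; ring
  have hmain : |2 + l| * (r * s i) ≤ r * (2 * s i - 2) := by
    rw [← hei, ← abs_mul, hrow]
    refine (abs_add_le _ _).trans ((add_le_add ((Finset.abs_sum_le_sum_abs _ _).trans hlow)
      ((Finset.abs_sum_le_sum_abs _ _).trans hhigh)).trans_eq ?_)
    simp only [s]; ring
  have hmain' : |2 + l| * s i ≤ 2 * s i - 2 := by
    refine le_of_mul_le_mul_left ?_ hr0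
    linarith
  have hs4 : 8 / ((n : ℝ) + 1) ^ 2 * s i ≤ 2 := by
    rw [div_mul_eq_mul_div, div_le_iff₀ (by positivity)]
    simp only [s]
    nlinarith [sq_nonneg (2 * (i : ℝ) + 1 - n)]
  refine le_of_mul_le_mul_right ?_ (hs i)
  linarith

/-- The `N × N` matrix with ones on the first subdiagonal and zeros elsewhere. -/
def lowerShift (N : ℕ) : Matrix (Fin N) (Fin N) ℝ :=
  fun i j => if (i : ℕ) = j + 1 then 1 else 0

lemma norm_vecMul_lowerShift_le {N : ℕ} (w : Fin N → ℝ) : ‖w ᵥ* lowerShift N‖ ≤ ‖w‖ := by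
  refine (pi_norm_le_iff_of_nonneg (norm_nonneg w)).mpr fun i => ?_
  rw [vecMul_eq_sum, Finset.sum_apply]
  refine (norm_sum_le _ _).trans ?_
  simp only [Pi.smul_apply, smul_eq_mul, lowerShift, mul_ite, mul_one, mul_zero,
    apply_ite norm, norm_zero]
  exact sum_ite_le_of_subsingleton _ (fun j k hj hk => Fin.ext (by omega)) _ (norm_nonneg w)
    fun j _ => norm_le_pi_norm w j

lemma norm_vecMul_lowerShift_transpose_le {N : ℕ} (w : Fin N → ℝ) :
    ‖w ᵥ* (lowerShift N)ᵀ‖ ≤ ‖w‖ := by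
  refine (pi_norm_le_iff_of_nonneg (norm_nonneg w)).mpr fun i => ?_
  rw [vecMul_eq_sum, Finset.sum_apply]
  refine (norm_sum_le _ _).trans ?_
  simp only [Pi.smul_apply, smul_eq_mul, lowerShift, transpose_apply, mul_ite, mul_one, mul_zero,
    apply_ite norm, norm_zero]
  exact sum_ite_le_of_subsingleton _ (fun j k hj hk => Fin.ext (by omega)) _ (norm_nonneg w)
    fun j _ => norm_le_pi_norm w j

open scoped Kronecker in
lemma blockBidiag_eq_kronecker {N n : ℕ} (D E : Matrix (Fin n) (Fin n) ℝ) :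
    blockBidiag D E = (1 : Matrix (Fin N) (Fin N) ℝ) ⊗ₖ D + lowerShift N ⊗ₖ E := by
  ext ⟨i, k⟩ ⟨j, l⟩
  simp only [blockBidiag, lowerShift, Matrix.add_apply, kroneckerMap_apply, one_apply, Fin.ext_iff]
  split_ifs <;> first | omega | simp

lemma blockBidiag_mulVec_vec {N n : ℕ} (D E : Matrix (Fin n) (Fin n) ℝ)
    (X : Matrix (Fin n) (Fin N) ℝ) :
    blockBidiag D E *ᵥ vec X = vec (D * X + E * X * (lowerShift N)ᵀ) := by
  rw [blockBidiag_eq_kronecker, add_mulVec, kronecker_mulVec_vec, kronecker_mulVec_vec,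
    transpose_one, Matrix.mul_one, vec_add]

lemma blockBidiag_transpose_mulVec_vec {N n : ℕ} (D E : Matrix (Fin n) (Fin n) ℝ)
    (X : Matrix (Fin n) (Fin N) ℝ) :
    (blockBidiag D E)ᵀ *ᵥ vec X = vec (Dᵀ * X + Eᵀ * X * lowerShift N) := by
  rw [blockBidiag_eq_kronecker, transpose_add, ← kroneckerMap_transpose,
    ← kroneckerMap_transpose, add_mulVec, kronecker_mulVec_vec, kronecker_mulVec_vec,
    transpose_one, transpose_one, Matrix.mul_one, transpose_transpose, vec_add]

/-- Norm bounds for a perturbation of `a • w` by `b` times a contraction of `w`. -/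
lemma norm_smul_sub_smul_bounds {E : Type*} [SeminormedAddCommGroup E] [NormedSpace ℝ E]
    {a b : ℝ} (ha : 0 ≤ a) {w w' : E} (hw : ‖w'‖ ≤ ‖w‖) :
    (a - |b|) * ‖w‖ ≤ ‖a • w - b • w'‖ ∧ ‖a • w - b • w'‖ ≤ (a + |b|) * ‖w‖ := by
  have h1 := norm_sub_norm_le (a • w) (b • w')
  have h2 := norm_sub_le (a • w) (b • w')
  rw [norm_smul, norm_smul, Real.norm_of_nonneg ha, Real.norm_eq_abs] at h1 h2
  have h3 := mul_le_mul_of_nonneg_left hw (abs_nonneg b)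
  constructor <;> linarith

lemma IsSingularValue.exists_mulVec_eq {ι : Type*} [Fintype ι] [DecidableEq ι]
    {M : Matrix ι ι ℝ} {σ : ℝ} (h : IsSingularValue M σ) :
    ∃ v ≠ 0, M *ᵥ (Mᵀ *ᵥ v) = σ ^ 2 • v := by
  have h2 := h.2
  rw [spectrum.mem_iff, isUnit_iff_isUnit_det, isUnit_iff_ne_zero, not_not] at h2
  obtain ⟨v, hv, hv'⟩ := exists_mulVec_eq_zero_iff.mpr h2
  refine ⟨v, hv, ?_⟩
  rw [sub_mulVec, sub_eq_zero, ← mulVec_mulVec, conjTranspose_eq_transpose_of_trivial] at hv'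
  rw [← hv', Algebra.algebraMap_eq_smul_one, smul_mulVec, one_mulVec]
  rfl

/-- A nonzero matrix is not annihilated by all eigenvectors of a symmetric matrix `H`. -/
lemma exists_eigenvector_vecMul_ne_zero {m n : Type*} [Fintype n] [DecidableEq n]
    {H : Matrix n n ℝ} (hH : H.IsHermitian) {X : Matrix n m ℝ} (hX : X ≠ 0) :
    ∃ (l : ℝ) (e : n → ℝ), H *ᵥ e = l • e ∧ e ᵥ* X ≠ 0 := by
  by_contra! hcon
  refine hX ?_
  ext i j
  have h0 : WithLp.toLp 2 (fun i => X i j) = (0 : EuclideanSpace ℝ n) := by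
    refine InnerProductSpace.ext_inner_left_basis hH.eigenvectorBasis.toBasis fun k => ?_
    have h1 := congrFun (hcon _ _ (hH.mulVec_eigenvectorBasis k)) j
    rw [inner_zero_right, OrthonormalBasis.coe_toBasis]
    simpa [PiLp.inner_apply, vecMul, dotProduct, mul_comm] using h1
  exact congrFun (congrArg WithLp.ofLp h0) i

/-- Singular values of a block bidiagonal matrix with symmetric blocks `D` and `-E`, where every
eigenvector of `H` is a common eigenvector of `D` and `E`. -/
lemma exists_eigenvalue_bounds_of_isSingularValue_blockBidiag {N n : ℕ}
    {H D E : Matrix (Fin n) (Fin n) ℝ} (hH : H.IsHermitian) (hD : Dᵀ = D) (hE : Eᵀ = E)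
    (a b : ℝ → ℝ) (hDa : ∀ l e, H *ᵥ e = l • e → D *ᵥ e = a l • e)
    (hEb : ∀ l e, H *ᵥ e = l • e → E *ᵥ e = b l • e)
    (hab : ∀ l e, e ≠ 0 → H *ᵥ e = l • e → |b l| ≤ a l) {σ : ℝ}
    (hσ : IsSingularValue (blockBidiag (N := N) D (-E)) σ) :
    ∃ (l : ℝ) (e : Fin n → ℝ), e ≠ 0 ∧ H *ᵥ e = l • e ∧
      a l - |b l| ≤ σ ∧ σ ≤ a l + |b l| := by
  obtain ⟨v, hv, hv'⟩ := hσ.exists_mulVec_eq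
  obtain ⟨X, rfl⟩ : ∃ X : Matrix (Fin n) (Fin N) ℝ, vec X = v := ⟨fun i j => v (j, i), rfl⟩
  have hX : X ≠ 0 := fun h => hv (by rw [h, vec_zero])
  obtain ⟨l, e, hl, hw⟩ := exists_eigenvector_vecMul_ne_zero hH hX
  have he : e ≠ 0 := fun h => hw (by rw [h, zero_vecMul])
  refine ⟨l, e, he, hl, ?_⟩
  have hab' := hab l e he hl
  have hDe : e ᵥ* D = a l • e := by rw [← mulVec_transpose, hD, hDa l e hl]
  have hEe : e ᵥ* E = b l • e := by rw [← mulVec_transpose, hE, hEb l e hl]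
  have key : ∀ (Y : Matrix (Fin n) (Fin N) ℝ) (S : Matrix (Fin N) (Fin N) ℝ),
      e ᵥ* (D * Y + -E * Y * S) = a l • (e ᵥ* Y) - b l • ((e ᵥ* Y) ᵥ* S) := fun Y S => by
    rw [vecMul_add, Matrix.neg_mul, Matrix.neg_mul, vecMul_neg, ← vecMul_vecMul, ← vecMul_vecMul,
      ← vecMul_vecMul, hDe, hEe, smul_vecMul, smul_vecMul, smul_vecMul, sub_eq_add_neg]
  rw [blockBidiag_transpose_mulVec_vec, transpose_neg, hD, hE, blockBidiag_mulVec_vec,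
    ← vec_smul, vec_inj] at hv'
  have hz := key X (lowerShift N)
  have hy := key (D * X + -E * X * lowerShift N) (lowerShift N)ᵀ
  rw [hv', vecMul_smul] at hy
  set w := e ᵥ* X
  set z := e ᵥ* (D * X + -E * X * lowerShift N)
  have ha : 0 ≤ a l := (abs_nonneg _).trans hab'
  have hw0 : 0 < ‖w‖ := norm_pos_iff.mpr hw
  obtain ⟨h1, h2⟩ := norm_smul_sub_smul_bounds (b := b l) ha (norm_vecMul_lowerShift_le w)
  obtain ⟨h3, h4⟩ :=
    norm_smul_sub_smul_bounds (b := b l) ha (norm_vecMul_lowerShift_transpose_le z)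
  rw [← hz] at h1 h2
  rw [← hy, norm_smul, Real.norm_of_nonneg (sq_nonneg σ)] at h3 h4
  have hlow : 0 ≤ a l - |b l| := sub_nonneg.mpr hab'
  have hhigh : 0 ≤ a l + |b l| := add_nonneg ha (abs_nonneg _)
  constructor
  · refine (sq_le_sq₀ hlow hσ.1).mp ?_
    refine le_of_mul_le_mul_right ?_ hw0
    calc (a l - |b l|) ^ 2 * ‖w‖ = (a l - |b l|) * ((a l - |b l|) * ‖w‖) := by ring
      _ ≤ (a l - |b l|) * ‖z‖ := mul_le_mul_of_nonneg_left h1 hlow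
      _ ≤ σ ^ 2 * ‖w‖ := h3
  · refine (sq_le_sq₀ hσ.1 hhigh).mp ?_
    refine le_of_mul_le_mul_right ?_ hw0
    calc σ ^ 2 * ‖w‖ ≤ (a l + |b l|) * ‖z‖ := h4
      _ ≤ (a l + |b l|) * ((a l + |b l|) * ‖w‖) := mul_le_mul_of_nonneg_left h2 hhigh
      _ = (a l + |b l|) ^ 2 * ‖w‖ := by ring

/-- **Singular-value bounds for the Crank–Nicolson scheme for the 1-D heat equation.**
With `h = 1/Nx`, `β = τ/h²`, `τ ≤ 1/8`, `A = I - (β/2)·L_h`, `B = I + (β/2)·L_h` and `L`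
the block bidiagonal space-time matrix with `A` on the block diagonal and `-B` on the
first block subdiagonal, every singular value `σ` of `L` satisfies
`8τ ≤ σ ≤ max 2 (4β)`. -/
theorem stmt8 (Nx Nt : ℕ) (hNx : 2 ≤ Nx) (hNt : 2 ≤ Nt) (h τ β : ℝ)
    (hh : h = 1 / Nx) (hτ : 0 < τ) (hβ : β = τ / h ^ 2) (hτ8 : τ ≤ 1 / 8)
    (A B : Matrix (Fin (Nx - 1)) (Fin (Nx - 1)) ℝ)
    (hA : A = 1 - (β / 2) • Lh (Nx - 1)) (hB : B = 1 + (β / 2) • Lh (Nx - 1))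
    (L : Matrix (Fin Nt × Fin (Nx - 1)) (Fin Nt × Fin (Nx - 1)) ℝ)
    (hL : L = blockBidiag A (-B)) :
    ∀ σ : ℝ, IsSingularValue L σ → 8 * τ ≤ σ ∧ σ ≤ max 2 (4 * β) := by
  intro σ hσ
  have hT : (Lh (Nx - 1))ᵀ = Lh (Nx - 1) := Lh_isHermitian (Nx - 1)
  have hNx0 : (0 : ℝ) < Nx := by exact_mod_cast (by omega : 0 < Nx)
  have hβN : β = τ * (Nx : ℝ) ^ 2 := by rw [hβ, hh]; field_simp
  have hβ0 : 0 < β := by rw [hβN]; positivity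
  have hcast : ((Nx - 1 : ℕ) : ℝ) + 1 = Nx := by exact_mod_cast (by omega : Nx - 1 + 1 = Nx)
  have hβτ : β * (8 / (Nx : ℝ) ^ 2) = 8 * τ := by rw [hβN]; field_simp
  have hbd : ∀ (l : ℝ) (e : Fin (Nx - 1) → ℝ), e ≠ 0 → Lh (Nx - 1) *ᵥ e = l • e →
      8 * τ ≤ -(β * l) ∧ -(β * l) ≤ 4 * β := fun l e he hl => by
    have h1 := abs_two_add_le_of_Lh_mulVec_eq he hl
    rw [hcast, abs_le] at h1
    have h2 := mul_le_mul_of_nonneg_left h1.1 hβ0.le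
    have h3 := mul_le_mul_of_nonneg_left h1.2 hβ0.le
    constructor <;> linarith
  subst hA hB hL
  obtain ⟨l, e, he, hl, hlow, hhigh⟩ :=
    exists_eigenvalue_bounds_of_isSingularValue_blockBidiag (Lh_isHermitian (Nx - 1))
      (by rw [transpose_sub, transpose_smul, transpose_one, hT])
      (by rw [transpose_add, transpose_smul, transpose_one, hT])
      (fun l => 1 - β / 2 * l) (fun l => 1 + β / 2 * l)
      (fun l e hl => by rw [sub_mulVec, one_mulVec, smul_mulVec, hl, smul_smul, sub_smul, one_smul])
      (fun l e hl => by rw [add_mulVec, one_mulVec, smul_mulVec, hl, smul_smul, add_smul, one_smul])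
      (fun l e he hl => by
        have := hbd l e he hl
        exact abs_le.mpr ⟨by linarith, by linarith⟩) hσ
  obtain ⟨h1, h2⟩ := hbd l e he hl
  constructor
  · refine le_trans ?_ hlow
    rcases abs_cases (1 + β / 2 * l) with h | h <;> linarith
  · refine hhigh.trans ?_
    rcases abs_cases (1 + β / 2 * l) with h | h
    · exact le_max_of_le_left (by linarith)
    · exact le_max_of_le_right (by linarith)
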